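/- Let H be a complex Hilbert space with dim H ≥ 3 and let φ be a bijection of the set of orthogonal projections on H onto itself such that for all projections P, Q: PQ = QP if and only if φ(P)φ(Q) = φ(Q)φ(P). Then there exists a unitary or antiunitary operator U : H → H such that for every projection P, φ(P) = U P U* or φ(P) = U (I − P) U*. (Theorem 4.4.) -/

import Mathlib

namespace PCP

variable {H : Type*} [NormedAddCommGroup H] [InnerProductSpace ℂ H]

/-- A group is not the union of two proper subgroups, phrased for additive maps. -/
theorem dichotomy {G K : Type*} [AddCommGroup G] [AddCommGroup K] (f h : G →+ K)
    (S : AddSubgroup G) (hS : ∀ x ∈ S, f x = 0 ∨ f x = h x) :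
    (∀ x ∈ S, f x = 0) ∨ (∀ x ∈ S, f x = h x) := by
  by_contra hcon
  push Not at hcon
  obtain ⟨⟨x, hx, hfx⟩, ⟨y, hy, hfy⟩⟩ := hcon
  have h1 := (hS x hx).resolve_left hfx
  have h2 := (hS y hy).resolve_right hfy
  rcases hS (x + y) (S.add_mem hx hy) with h3 | h3
  · rw [map_add, h2, add_zero] at h3
    exact hfx h3
  · rw [map_add, map_add, h1] at h3
    exact hfy (add_left_cancel h3)

theorem exists_orth (hdim : 3 ≤ Module.rank ℂ H) (x y : H) :
    ∃ z : H, z ≠ 0 ∧ inner ℂ x z = 0 ∧ inner ℂ y z = 0 := by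
  by_contra hcon
  push Not at hcon
  have hbot : (Submodule.span ℂ {x, y})ᗮ = ⊥ := by
    rw [Submodule.eq_bot_iff]
    intro z hz
    rw [Submodule.mem_orthogonal] at hz
    by_contra hz0
    exact hcon z hz0 (hz x (Submodule.subset_span (by simp)))
      (hz y (Submodule.subset_span (by simp)))
  have : FiniteDimensional ℂ (Submodule.span ℂ ({x, y} : Set H)) :=
    FiniteDimensional.span_of_finite ℂ (Set.toFinite _)
  rw [Submodule.orthogonal_eq_bot_iff] at hbot
  have h1 := rank_span_le (R := ℂ) ({x, y} : Set H)
  rw [hbot, rank_top] at h1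
  have h2 : Cardinal.mk ({x, y} : Set H) ≤ 2 := by
    refine (Cardinal.mk_insert_le).trans ?_
    rw [Cardinal.mk_singleton]; norm_num
  have h3 := (hdim.trans h1).trans h2
  norm_num at h3

theorem mem_pair_of_orth {x y z : H}
    (h : ∀ k : H, inner ℂ x k = 0 → inner ℂ y k = 0 → inner ℂ z k = 0) :
    ∃ a b : ℂ, z = a • x + b • y := by
  have : FiniteDimensional ℂ (Submodule.span ℂ ({x, y} : Set H)) :=
    FiniteDimensional.span_of_finite ℂ (Set.toFinite _)
  have : z ∈ (Submodule.span ℂ ({x, y} : Set H))ᗮᗮ := by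
    rw [Submodule.mem_orthogonal]
    intro k hk
    rw [Submodule.mem_orthogonal] at hk
    rw [inner_eq_zero_symm]
    exact h k (hk x (Submodule.subset_span (by simp))) (hk y (Submodule.subset_span (by simp)))
  rw [Submodule.orthogonal_orthogonal, Submodule.mem_span_pair] at this
  obtain ⟨a, b, hab⟩ := this
  exact ⟨a, b, hab.symm⟩

/-- A map inducing an orthogonality preserving bijection on lines. -/
structure OM (g : H → H) : Prop where
  zero : g 0 = 0
  ne : ∀ x, x ≠ 0 → g x ≠ 0
  orth : ∀ x y, inner ℂ x y = 0 ↔ inner ℂ (g x) (g y) = 0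
  surj : ∀ w, ∃ x, ∃ c : ℂ, w = c • g x

theorem OM.coplanar {g : H → H} (h : OM g) (x y : H) (a b : ℂ) :
    ∃ c d : ℂ, g (a • x + b • y) = c • g x + d • g y := by
  apply mem_pair_of_orth
  intro k h1 h2
  obtain ⟨k0, c, rfl⟩ := h.surj k
  rw [inner_smul_right] at h1 h2 ⊢
  by_cases hc : c = 0
  · simp [hc]
  have h1' := (h.orth _ _).2 ((mul_eq_zero.1 h1).resolve_left hc)
  have h2' := (h.orth _ _).2 ((mul_eq_zero.1 h2).resolve_left hc)
  rw [(h.orth _ _).1, mul_zero]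
  rw [inner_add_left, inner_smul_left, inner_smul_left, h1', h2']
  simp

theorem OM.inj {g : H → H} (h : OM g) (x y : H) (c : ℂ) (hc : g y = c • g x) :
    ∃ d : ℂ, y = d • x := by
  have : ∃ a b : ℂ, y = a • x + b • x := by
    apply mem_pair_of_orth
    intro k h1 _
    rw [h.orth, hc, inner_smul_left, (h.orth _ _).1 h1, mul_zero]
  obtain ⟨a, b, hab⟩ := this
  exact ⟨a + b, by rw [hab, add_smul]⟩

/-- The normalised action on the affine hyperplane `e + e^⊥`. -/
noncomputable def A (g : H → H) (e e' x : H) : H :=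
  (inner ℂ e' (g (e + x)))⁻¹ • g (e + x) - e'

structure OMe (g : H → H) (e e' : H) : Prop extends OM g where
  he : ‖e‖ = 1
  he' : ‖e'‖ = 1
  ex : ∃ c : ℂ, c ≠ 0 ∧ e' = c • g e

variable {g : H → H} {e e' : H}

theorem OMe.orth_e (h : OMe g e e') (x : H) : inner ℂ e x = 0 ↔ inner ℂ e' (g x) = 0 := by
  obtain ⟨c, hc, hec⟩ := h.ex
  rw [h.orth, hec, inner_smul_left, mul_eq_zero]
  simp [hc]

theorem OMe.inner_ee (h : OMe g e e') : inner ℂ e e = (1 : ℂ) := by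
  rw [inner_self_eq_norm_sq_to_K, h.he]; simp

theorem OMe.inner_ee' (h : OMe g e e') : inner ℂ e' e' = (1 : ℂ) := by
  rw [inner_self_eq_norm_sq_to_K, h.he']; simp

theorem OMe.coef_ne (h : OMe g e e') {x : H} (hx : inner ℂ e x = 0) :
    inner ℂ e' (g (e + x)) ≠ 0 := by
  rw [Ne, ← h.orth_e, inner_add_right, hx, h.inner_ee]; simp

theorem OMe.A1 (h : OMe g e e') {x : H} (hx : inner ℂ e x = 0) :
    g (e + x) = (inner ℂ e' (g (e + x))) • (e' + A g e e' x) := by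
  rw [A, add_sub_cancel, smul_smul, mul_inv_cancel₀ (h.coef_ne hx), one_smul]

theorem OMe.A2 (h : OMe g e e') {x : H} (hx : inner ℂ e x = 0) :
    inner ℂ e' (A g e e' x) = 0 := by
  rw [A, inner_sub_right, inner_smul_right, inv_mul_cancel₀ (h.coef_ne hx), h.inner_ee', sub_self]

theorem OMe.Aeq (h : OMe g e e') {x w : H} {t : ℂ} (hx : inner ℂ e x = 0)
    (hw : inner ℂ e' w = 0) (hg : g (e + x) = t • (e' + w)) : A g e e' x = w := by
  have h1 : inner ℂ e' (g (e + x)) = t := by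
    rw [hg, inner_smul_right, inner_add_right, hw, h.inner_ee']; simp
  have ht : t ≠ 0 := h1 ▸ h.coef_ne hx
  rw [A, h1, hg, smul_smul, inv_mul_cancel₀ ht, one_smul, add_sub_cancel_left]

theorem OMe.A_zero (h : OMe g e e') : A g e e' 0 = 0 := by
  obtain ⟨c, hc, hec⟩ := h.ex
  apply h.Aeq (t := c⁻¹) (by simp) (by simp)
  rw [add_zero, add_zero, hec, smul_smul, inv_mul_cancel₀ hc, one_smul]

theorem OMe.A3 (h : OMe g e e') {x : H} (hx : inner ℂ e x = 0) :
    ∃ t : ℂ, g x = t • A g e e' x := by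
  obtain ⟨c, d, hcd⟩ := h.coplanar (e + x) e 1 (-1)
  have hx' : (1 : ℂ) • (e + x) + (-1 : ℂ) • e = x := by simp
  obtain ⟨k, hk, hek⟩ := h.ex
  have hge : g e = k⁻¹ • e' := by rw [hek, smul_smul, inv_mul_cancel₀ hk, one_smul]
  rw [hx', h.A1 hx, hge, smul_smul, smul_smul] at hcd
  set s := c * inner ℂ e' (g (e + x))
  have h0 := (h.orth_e x).1 hx
  rw [hcd, inner_add_right, inner_smul_right, inner_smul_right, inner_add_right, h.A2 hx,
    h.inner_ee'] at h0
  refine ⟨s, ?_⟩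
  have : d * k⁻¹ = -s := by linear_combination h0
  rw [hcd, this, smul_add, neg_smul]; abel

theorem OMe.A4 (h : OMe g e e') {x : H} (hx : inner ℂ e x = 0) :
    ∃ t : ℂ, A g e e' x = t • g x := by
  by_cases h0 : x = 0
  · exact ⟨0, by rw [h0, h.A_zero, zero_smul]⟩
  obtain ⟨t, ht⟩ := h.A3 hx
  have ht0 : t ≠ 0 := by
    rintro rfl
    exact h.ne x h0 (by simpa using ht)
  exact ⟨t⁻¹, by rw [ht, smul_smul, inv_mul_cancel₀ ht0, one_smul]⟩

theorem OMe.A_add_half (h : OMe g e e') {x y : H} (hx : inner ℂ e x = 0) (hy : inner ℂ e y = 0) :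
    ∃ c : ℂ, A g e e' (x + y) = A g e e' x + c • A g e e' y := by
  obtain ⟨c, d, hcd⟩ := h.coplanar (e + x) y 1 1
  rw [one_smul, one_smul, add_assoc, h.A1 hx] at hcd
  obtain ⟨t, ht⟩ := h.A3 hy
  rw [ht, smul_smul, smul_smul] at hcd
  set s := c * inner ℂ e' (g (e + x))
  have hxy : inner ℂ e (x + y) = 0 := by rw [inner_add_right, hx, hy, add_zero]
  have hs : s ≠ 0 := by
    intro hs
    apply h.coef_ne hxy
    rw [hcd, hs, zero_smul, zero_add, inner_smul_right, h.A2 hy, mul_zero]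
  refine ⟨s⁻¹ * (d * t), ?_⟩
  apply h.Aeq hxy (t := s)
  · rw [inner_add_right, inner_smul_right, h.A2 hx, h.A2 hy]; simp
  · rw [hcd, ← add_assoc, smul_add s (e' + _), smul_smul, mul_inv_cancel_left₀ hs]

theorem OMe.A_add_indep (h : OMe g e e') {x y : H} (hx : inner ℂ e x = 0) (hy : inner ℂ e y = 0)
    (hxy : ∀ d : ℂ, y ≠ d • x) : A g e e' (x + y) = A g e e' x + A g e e' y := by
  obtain ⟨c, hc⟩ := h.A_add_half hx hy
  obtain ⟨d, hd⟩ := h.A_add_half hy hx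
  by_cases hc1 : c = 1
  · rw [hc, hc1, one_smul]
  exfalso
  rw [add_comm y x, hc] at hd
  have h1 : (1 - c) ≠ 0 := sub_ne_zero.2 (Ne.symm hc1)
  have h2 : (1 - c) • A g e e' y = (1 - d) • A g e e' x := by
    rw [sub_smul, sub_smul, one_smul, one_smul, sub_eq_sub_iff_add_eq_add, ← hd]
  have h3 : A g e e' y = ((1 - c)⁻¹ * (1 - d)) • A g e e' x := by
    rw [mul_smul, ← h2, smul_smul, inv_mul_cancel₀ h1, one_smul]
  obtain ⟨t, ht⟩ := h.A3 hy
  obtain ⟨s, hs⟩ := h.A4 hx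
  obtain ⟨k, hk⟩ := h.inj x y (t * ((1 - c)⁻¹ * (1 - d)) * s) (by
    rw [ht, h3, hs, smul_smul, smul_smul, mul_assoc])
  exact hxy k hk

theorem not_smul_of_orth {x z : H} (hz : z ≠ 0) (hxz : inner ℂ x z = 0) (d : ℂ) : z ≠ d • x := by
  intro hd
  apply hz
  rw [← inner_self_eq_zero (𝕜 := ℂ)]
  nth_rw 1 [hd]
  rw [inner_smul_left, hxz, mul_zero]

theorem OMe.A_add (hdim : 3 ≤ Module.rank ℂ H) (h : OMe g e e') {x y : H} (hx : inner ℂ e x = 0)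
    (hy : inner ℂ e y = 0) : A g e e' (x + y) = A g e e' x + A g e e' y := by
  by_cases hxy : ∀ d : ℂ, y ≠ d • x
  · exact h.A_add_indep hx hy hxy
  push Not at hxy
  obtain ⟨d, rfl⟩ := hxy
  obtain ⟨z, hz0, hez, hxz⟩ := exists_orth hdim e x
  have hxy' : inner ℂ e (x + d • x) = 0 := by rw [inner_add_right, hx, hy, add_zero]
  have e1 : A g e e' ((x + d • x) + z) = A g e e' (x + d • x) + A g e e' z := by
    apply h.A_add_indep hxy' hez
    apply not_smul_of_orth hz0
    rw [inner_add_left, inner_smul_left, hxz]; simp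
  have e2 : A g e e' (x + (d • x + z)) = A g e e' x + A g e e' (d • x + z) := by
    apply h.A_add_indep hx (by rw [inner_add_right, hy, hez, add_zero])
    intro k hk
    apply not_smul_of_orth hz0 hxz (k - d)
    rw [sub_smul, ← hk, add_sub_cancel_left]
  have e3 : A g e e' (d • x + z) = A g e e' (d • x) + A g e e' z := by
    apply h.A_add_indep hy hez
    apply not_smul_of_orth hz0
    rw [inner_smul_left, hxz]; simp
  rw [e3, ← add_assoc, e1, ← add_assoc] at e2
  exact add_right_cancel e2

theorem OMe.A_neg (hdim : 3 ≤ Module.rank ℂ H) (h : OMe g e e') {x : H} (hx : inner ℂ e x = 0) :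
    A g e e' (-x) = -A g e e' x := by
  have := h.A_add hdim hx (y := -x) (by rw [inner_neg_right, hx, neg_zero])
  rw [add_neg_cancel, h.A_zero] at this
  exact (neg_eq_of_add_eq_zero_right this.symm).symm

theorem OMe.A_unit (hdim : 3 ≤ Module.rank ℂ H) (h : OMe g e e') {x : H} (hx : inner ℂ e x = 0)
    (hx1 : ‖x‖ = 1) : ‖A g e e' x‖ = 1 := by
  have hx' : inner ℂ e (-x) = 0 := by rw [inner_neg_right, hx, neg_zero]
  have hxe : inner ℂ x e = 0 := by rw [inner_eq_zero_symm, hx]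
  have hxx : inner ℂ x x = (1 : ℂ) := by rw [inner_self_eq_norm_sq_to_K, hx1]; simp
  have h1 : inner ℂ (e + x) (e + -x) = 0 := by
    rw [inner_add_left, inner_add_right, inner_add_right, inner_neg_right, inner_neg_right,
      hx, hxe, hxx, h.inner_ee]; simp
  have hA := h.A2 hx
  have hA' : inner ℂ (A g e e' x) e' = 0 := by rw [inner_eq_zero_symm, hA]
  rw [h.orth, h.A1 hx, h.A1 hx', inner_smul_left, inner_smul_right, mul_eq_zero, mul_eq_zero,
    or_iff_right ((map_ne_zero _).2 (h.coef_ne hx)), or_iff_right (h.coef_ne hx'), h.A_neg hdim hx,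
    inner_add_left, inner_add_right, inner_add_right, inner_neg_right, inner_neg_right,
      hA, hA', h.inner_ee', inner_self_eq_norm_sq_to_K] at h1
  have h2 : ((‖A g e e' x‖ ^ 2 : ℝ) : ℂ) = (1 : ℝ) := by
    push_cast
    simp only [Complex.coe_algebraMap] at h1
    linear_combination -h1
  have h3 : ‖A g e e' x‖ ^ 2 = 1 := by exact_mod_cast h2
  nlinarith [norm_nonneg (A g e e' x), sq_nonneg (‖A g e e' x‖ - 1)]

theorem OMe.A_le2 (hdim : 3 ≤ Module.rank ℂ H) (h : OMe g e e') {x : H} (hx : inner ℂ e x = 0)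
    (hx2 : ‖x‖ ≤ 2) : ‖A g e e' x‖ ≤ 2 := by
  obtain ⟨z, hz0, hez, hxz⟩ := exists_orth hdim e x
  set s : ℝ := √(1 - ‖x‖ ^ 2 / 4) / ‖z‖ with hs
  have hzn : ‖z‖ ≠ 0 := norm_ne_zero_iff.2 hz0
  have hnn : 0 ≤ 1 - ‖x‖ ^ 2 / 4 := by nlinarith [norm_nonneg x]
  have hsz : s ^ 2 * ‖z‖ ^ 2 = 1 - ‖x‖ ^ 2 / 4 := by
    rw [hs, div_pow, Real.sq_sqrt hnn]; field_simp
  have key : ∀ t : ℝ, t ^ 2 = s ^ 2 → ‖A g e e' (((1 / 2 : ℝ) : ℂ) • x + (t : ℂ) • z)‖ = 1 := by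
    intro t ht
    apply h.A_unit hdim
    · rw [inner_add_right, inner_smul_right, inner_smul_right, hx, hez]; simp
    · have h1 : ‖((1 / 2 : ℝ) : ℂ) • x + (t : ℂ) • z‖ ^ 2 = 1 := by
        rw [sq, norm_add_sq_eq_norm_sq_add_norm_sq_of_inner_eq_zero (𝕜 := ℂ), norm_smul, norm_smul,
          Complex.norm_real, Complex.norm_real, Real.norm_eq_abs, Real.norm_eq_abs]
        · have := sq_abs t
          have h2 : |(1 / 2 : ℝ)| = 1 / 2 := abs_of_pos (by norm_num)
          rw [h2]
          have e1 : |t| * ‖z‖ * (|t| * ‖z‖) = |t| ^ 2 * ‖z‖ ^ 2 := by ring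
          rw [e1, this, ht, hsz]; ring
        · rw [inner_smul_left, inner_smul_right, hxz]; simp
      nlinarith [norm_nonneg (((1 / 2 : ℝ) : ℂ) • x + (t : ℂ) • z),
        sq_nonneg (‖((1 / 2 : ℝ) : ℂ) • x + (t : ℂ) • z‖ - 1)]
  have hsum : x = (((1 / 2 : ℝ) : ℂ) • x + (s : ℂ) • z) +
      (((1 / 2 : ℝ) : ℂ) • x + ((-s : ℝ) : ℂ) • z) := by
    have : ((1 / 2 : ℝ) : ℂ) + ((1 / 2 : ℝ) : ℂ) = 1 := by push_cast; norm_num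
    rw [add_add_add_comm, ← add_smul, this, one_smul, Complex.ofReal_neg, neg_smul,
      add_neg_cancel, add_zero]
  have ho : ∀ t : ℝ, inner ℂ e (((1 / 2 : ℝ) : ℂ) • x + (t : ℂ) • z) = 0 := by
    intro t
    rw [inner_add_right, inner_smul_right, inner_smul_right, hx, hez]; simp
  rw [hsum, h.A_add hdim (ho _) (ho _)]
  refine (norm_add_le _ _).trans ?_
  rw [key s rfl, key (-s) (by ring)]
  norm_num

end PCP

namespace PCP

variable {H : Type*} [NormedAddCommGroup H] [InnerProductSpace ℂ H]
variable {g : H → H} {e e' : H}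

noncomputable def pe (e : H) : H →ₗ[ℂ] H where
  toFun v := v - inner ℂ e v • e
  map_add' x y := by rw [inner_add_right, add_smul]; abel
  map_smul' c x := by
    rw [inner_smul_right, smul_sub, smul_smul]; rfl

theorem pe_apply (e v : H) : pe e v = v - inner ℂ e v • e := rfl

theorem OMe.inner_pe (h : OMe g e e') (v : H) : inner ℂ e (pe e v) = 0 := by
  rw [pe_apply, inner_sub_right, inner_smul_right, h.inner_ee, mul_one, sub_self]

theorem pe_of_orth {x : H} (hx : inner ℂ e x = 0) : pe e x = x := by
  rw [pe_apply, hx, zero_smul, sub_zero]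

theorem OMe.pe_e (h : OMe g e e') : pe e e = 0 := by
  rw [pe_apply, h.inner_ee, one_smul, sub_self]

theorem pythag {u w : H} (hu : ‖u‖ = 1) (huw : inner ℂ u w = 0) (a : ℂ) :
    ‖a • u + w‖ ^ 2 = ‖a‖ ^ 2 + ‖w‖ ^ 2 := by
  rw [sq, norm_add_sq_eq_norm_sq_add_norm_sq_of_inner_eq_zero (𝕜 := ℂ), norm_smul, hu]
  · ring
  · rw [inner_smul_left, huw, mul_zero]

theorem OMe.norm_pe (h : OMe g e e') (v : H) : ‖v‖ ^ 2 = ‖inner ℂ e v‖ ^ 2 + ‖pe e v‖ ^ 2 := by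
  rw [← pythag h.he (h.inner_pe v)]
  rw [pe_apply, add_sub_cancel]

/-- `A` precomposed with the projection, additive -/
noncomputable def B0 (hdim : 3 ≤ Module.rank ℂ H) (h : OMe g e e') : H →+ H where
  toFun v := A g e e' (pe e v)
  map_zero' := by rw [map_zero, h.A_zero]
  map_add' x y := by rw [map_add, h.A_add hdim (h.inner_pe x) (h.inner_pe y)]

theorem B0_apply (hdim : 3 ≤ Module.rank ℂ H) (h : OMe g e e') (v : H) :
    B0 hdim h v = A g e e' (pe e v) := rfl

theorem B0_bound (hdim : 3 ≤ Module.rank ℂ H) (h : OMe g e e') (v : H) :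
    ‖B0 hdim h v‖ ≤ 2 * ‖v‖ := by
  by_cases hv : v = 0
  · simp [hv]
  have hv' : 0 < ‖v‖ := norm_pos_iff.2 hv
  obtain ⟨q, hq1, hq2⟩ := exists_rat_btwn (show 1 / ‖v‖ < 2 / ‖v‖ by gcongr; norm_num)
  have hq0 : (0 : ℝ) < q := lt_trans (by positivity) hq1
  have h1 : B0 hdim h ((q : ℝ) • v) = (q : ℝ) • B0 hdim h v := map_ratCast_smul _ ℝ ℝ q v
  have h2 : ‖(q : ℝ) • v‖ = q * ‖v‖ := by rw [norm_smul, Real.norm_of_nonneg hq0.le]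
  rw [div_lt_iff₀ hv'] at hq1
  rw [lt_div_iff₀ hv'] at hq2
  have h3 : ‖B0 hdim h ((q : ℝ) • v)‖ ≤ 2 := by
    rw [B0_apply]
    apply h.A_le2 hdim (h.inner_pe _)
    have := h.norm_pe ((q : ℝ) • v)
    rw [h2] at this
    have h4 : ‖pe e ((q : ℝ) • v)‖ ^ 2 ≤ (q * ‖v‖) ^ 2 := by
      rw [this]; nlinarith [sq_nonneg ‖inner ℂ e ((q : ℝ) • v)‖]
    have h5 := abs_le_of_sq_le_sq h4 (by positivity)
    exact (le_abs_self _).trans (h5.trans hq2.le)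
  rw [h1, norm_smul, Real.norm_of_nonneg hq0.le] at h3
  have h6 : q * ‖B0 hdim h v‖ ≤ q * (2 * ‖v‖) := by linarith
  exact le_of_mul_le_mul_left h6 hq0

/-- `B0` as a real-linear map. -/
noncomputable def B (hdim : 3 ≤ Module.rank ℂ H) (h : OMe g e e') : H →L[ℝ] H :=
  (B0 hdim h).toRealLinearMap (AddMonoidHomClass.continuous_of_bound _ 2 (B0_bound hdim h))

theorem B_apply (hdim : 3 ≤ Module.rank ℂ H) (h : OMe g e e') (v : H) :
    B hdim h v = A g e e' (pe e v) := rfl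

theorem B_norm (hdim : 3 ≤ Module.rank ℂ H) (h : OMe g e e') {x : H} (hx : inner ℂ e x = 0) :
    ‖B hdim h x‖ = ‖x‖ := by
  by_cases hv : x = 0
  · simp [hv]
  have hv' : ‖x‖ ≠ 0 := norm_ne_zero_iff.2 hv
  have h1 : ‖B hdim h ((‖x‖⁻¹ : ℝ) • x)‖ = 1 := by
    have h0 : inner ℂ e ((‖x‖⁻¹ : ℝ) • x) = 0 := by
      rw [inner_smul_right_eq_smul, hx, smul_zero]
    rw [B_apply, pe_of_orth h0]
    apply h.A_unit hdim h0
    rw [norm_smul, norm_inv, norm_norm, inv_mul_cancel₀ hv']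
  rw [map_smul, norm_smul, norm_inv, norm_norm] at h1
  field_simp at h1
  exact h1

theorem B_orth (hdim : 3 ≤ Module.rank ℂ H) (h : OMe g e e') (x : H) :
    inner ℂ e' (B hdim h x) = 0 := by
  rw [B_apply]; exact h.A2 (h.inner_pe x)

theorem B_I (hdim : 3 ≤ Module.rank ℂ H) (h : OMe g e e') {x : H} (hx : inner ℂ e x = 0) :
    B hdim h (Complex.I • x) = Complex.I • B hdim h x ∨
    B hdim h (Complex.I • x) = -(Complex.I • B hdim h x) := by
  by_cases hx0 : x = 0
  · simp [hx0]
  have hIx : inner ℂ e (Complex.I • x) = 0 := by rw [inner_smul_right, hx, mul_zero]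
  obtain ⟨c, hc⟩ : ∃ c : ℂ, B hdim h (Complex.I • x) = c • B hdim h x := by
    rw [B_apply, B_apply, pe_of_orth hx, pe_of_orth hIx]
    obtain ⟨a, ha⟩ := h.A4 hIx
    obtain ⟨b, hb⟩ := h.A3 hx
    obtain ⟨k, l, hkl⟩ := h.coplanar x x Complex.I 0
    rw [zero_smul, add_zero, ← add_smul] at hkl
    exact ⟨a * ((k + l) * b), by rw [ha, hkl, hb, smul_smul, smul_smul, mul_assoc]⟩
  have hn : 0 < ‖B hdim h x‖ := by rw [B_norm hdim h hx]; exact norm_pos_iff.2 hx0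
  have hc1 : ‖c‖ = 1 := by
    have := B_norm hdim h hIx
    rw [hc, norm_smul, norm_smul, Complex.norm_I, one_mul, ← B_norm hdim h hx] at this
    exact mul_right_cancel₀ hn.ne' (by rw [this, one_mul])
  have hc2 : ‖1 + c‖ ^ 2 = 2 := by
    have h0 : inner ℂ e (x + Complex.I • x) = 0 := by rw [inner_add_right, hx, hIx, add_zero]
    have := B_norm hdim h h0
    rw [map_add, hc] at this
    have e1 : B hdim h x + c • B hdim h x = (1 + c) • B hdim h x := by rw [add_smul, one_smul]
    have e2 : x + Complex.I • x = (1 + Complex.I) • x := by rw [add_smul, one_smul]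
    rw [e1, e2, norm_smul, norm_smul, ← B_norm hdim h hx] at this
    rw [mul_right_cancel₀ hn.ne' this, ← Complex.normSq_eq_norm_sq, Complex.normSq_apply]
    simp; norm_num
  have hc3 : ‖c‖ ^ 2 = 1 := by rw [hc1]; norm_num
  rw [← Complex.normSq_eq_norm_sq, Complex.normSq_apply] at hc2 hc3
  simp only [Complex.add_re, Complex.add_im, Complex.one_re, Complex.one_im] at hc2
  have hre : c.re = 0 := by nlinarith
  have him : (c.im - 1) * (c.im + 1) = 0 := by rw [hre] at hc3; linarith
  rcases mul_eq_zero.1 him with h1 | h1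
  · left
    rw [hc, show c = Complex.I from Complex.ext (by simp [hre]) (by simp; linarith)]
  · right
    rw [hc, show c = -Complex.I from Complex.ext (by simp [hre]) (by simp; linarith), neg_smul]

theorem B_semi (hdim : 3 ≤ Module.rank ℂ H) (h : OMe g e e') :
    (∀ x, B hdim h (Complex.I • x) = Complex.I • B hdim h x) ∨
    (∀ x, B hdim h (Complex.I • x) = -(Complex.I • B hdim h x)) := by
  let f1 : H →+ H := ((B hdim h : H →ₗ[ℝ] H) : H →+ H).comp (DistribSMul.toAddMonoidHom H Complex.I)
  let f2 : H →+ H := (DistribSMul.toAddMonoidHom H Complex.I).comp ((B hdim h : H →ₗ[ℝ] H) : H →+ H)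
  have hf1 : ∀ x, f1 x = B hdim h (Complex.I • x) := fun _ => rfl
  have hf2 : ∀ x, f2 x = Complex.I • B hdim h x := fun _ => rfl
  have hBpe : ∀ x, B hdim h x = B hdim h (pe e x) := by
    intro x; rw [B_apply, B_apply, pe_of_orth (h.inner_pe x)]
  have := dichotomy (f1 - f2) (-f2 - f2) ⊤ (by
    intro x _
    simp only [AddMonoidHom.sub_apply, AddMonoidHom.neg_apply, hf1, hf2]
    rcases B_I hdim h (h.inner_pe x) with h1 | h1
    · left; rw [hBpe, map_smul, h1, ← hBpe, sub_self]
    · right; rw [hBpe, map_smul, h1, ← hBpe])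
  rcases this with h1 | h1
  · left; intro x
    have := h1 x trivial
    simpa only [AddMonoidHom.sub_apply, AddMonoidHom.neg_apply, hf1, hf2, sub_eq_zero] using this
  · right; intro x
    have := h1 x trivial
    simpa only [AddMonoidHom.sub_apply, AddMonoidHom.neg_apply, hf1, hf2, sub_left_inj] using this

theorem B_smul (hdim : 3 ≤ Module.rank ℂ H) (h : OMe g e e') :
    ∃ s : ℂ ≃ₐ[ℝ] ℂ, ((∀ z, s z = z) ∨ (∀ z, s z = (starRingEnd ℂ) z)) ∧
      ∀ (z : ℂ) (x : H), B hdim h (z • x) = s z • B hdim h x := by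
  have dec : ∀ (z : ℂ) (x : H), z • x = z.re • x + z.im • (Complex.I • x) := by
    intro z x
    nth_rw 1 [← Complex.re_add_im z]
    rw [add_smul, mul_smul, Complex.coe_smul, Complex.coe_smul]
  rcases B_semi hdim h with h1 | h1
  · refine ⟨AlgEquiv.refl, Or.inl fun _ => rfl, fun z x => ?_⟩
    rw [dec, map_add, map_smul, map_smul, h1, ← dec]; rfl
  · refine ⟨Complex.conjAe, Or.inr fun _ => rfl, fun z x => ?_⟩
    rw [dec z, map_add, map_smul, map_smul, h1, Complex.conjAe_coe, dec (starRingEnd ℂ z)]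
    simp

theorem uhlhorn_e (hdim : 3 ≤ Module.rank ℂ H) (h : OMe g e e') :
    ∃ U : H ≃ₗᵢ[ℝ] H,
      ((∀ (z : ℂ) (x : H), U (z • x) = z • U x) ∨
        (∀ (z : ℂ) (x : H), U (z • x) = (starRingEnd ℂ z) • U x)) ∧
      ∀ x, ∃ c : ℂ, U x = c • g x := by
  obtain ⟨s, hs, hB⟩ := B_smul hdim h
  have hsn : ∀ z, ‖s z‖ = ‖z‖ := by
    intro z
    rcases hs with hs | hs
    · rw [hs]
    · rw [hs, RCLike.norm_conj]
  have hsr : ∀ (r : ℝ) z, s (r • z) = r • s z := by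
    intro r z
    rcases hs with hs | hs
    · rw [hs, hs]
    · rw [hs, hs]; simp
  have hpe : ∀ v : H, inner ℂ e v • e + pe e v = v := by
    intro v; rw [pe_apply, add_sub_cancel]
  let U0 : H →ₗ[ℝ] H :=
    { toFun := fun v => s (inner ℂ e v) • e' + B hdim h v
      map_add' := fun x y => by
        rw [inner_add_right, map_add, map_add, add_smul]; abel
      map_smul' := fun r x => by
        rw [map_smul, inner_smul_right_eq_smul, hsr, smul_add, smul_assoc]; rfl }
  have hU0 : ∀ v, U0 v = s (inner ℂ e v) • e' + B hdim h v := fun _ => rfl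
  have hBpe : ∀ x, B hdim h x = B hdim h (pe e x) := by
    intro x; rw [B_apply, B_apply, pe_of_orth (h.inner_pe x)]
  have hnorm : ∀ v, ‖U0 v‖ = ‖v‖ := by
    intro v
    have h1 : ‖U0 v‖ ^ 2 = ‖v‖ ^ 2 := by
      rw [hU0, pythag h.he' (B_orth hdim h v), hsn, h.norm_pe v, hBpe, B_norm hdim h (h.inner_pe v)]
    exact (sq_eq_sq₀ (norm_nonneg _) (norm_nonneg _)).1 h1
  have hsm : ∀ (z : ℂ) x, U0 (z • x) = s z • U0 x := by
    intro z x
    rw [hU0, hU0, hB, inner_smul_right, map_mul, smul_add, smul_smul]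
  have hline1 : ∀ x, inner ℂ e x = 0 → U0 x = A g e e' x := by
    intro x hx
    rw [hU0, hx, map_zero, zero_smul, zero_add, B_apply, pe_of_orth hx]
  have hline2 : ∀ x, inner ℂ e x = 0 → U0 (e + x) = e' + A g e e' x := by
    intro x hx
    rw [map_add, hline1 x hx, hU0 e, h.inner_ee, map_one, one_smul, B_apply, h.pe_e, h.A_zero,
      add_zero]
  -- every vector off `e^⊥` is a multiple of some `e + x`
  have hdec : ∀ v, inner ℂ e v ≠ 0 → ∃ x, inner ℂ e x = 0 ∧ v = inner ℂ e v • (e + x) := by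
    intro v hv
    refine ⟨(inner ℂ e v)⁻¹ • pe e v, ?_, ?_⟩
    · rw [inner_smul_right, h.inner_pe, mul_zero]
    · rw [smul_add, smul_smul, mul_inv_cancel₀ hv, one_smul, hpe]
  have hgs : ∀ (c : ℂ) (x : H), ∃ k : ℂ, g (c • x) = k • g x := by
    intro c x
    obtain ⟨k, l, hkl⟩ := h.coplanar x x c 0
    rw [zero_smul, add_zero, ← add_smul] at hkl
    exact ⟨_, hkl⟩
  have hline : ∀ v, ∃ c : ℂ, g v = c • U0 v := by
    intro v
    by_cases hv : inner ℂ e v = 0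
    · rw [hline1 v hv]; exact h.A3 hv
    · obtain ⟨x, hx, hvx⟩ := hdec v hv
      obtain ⟨k, hk⟩ := hgs (inner ℂ e v) (e + x)
      have hsv : s (inner ℂ e v) ≠ 0 := by
        rw [← norm_ne_zero_iff, hsn]; exact norm_ne_zero_iff.2 hv
      have h1 : e' + A g e e' x = (s (inner ℂ e v))⁻¹ • U0 v := by
        rw [← hline2 x hx]
        nth_rw 2 [hvx]
        rw [hsm, smul_smul, inv_mul_cancel₀ hsv, one_smul]
      rw [← hvx, h.A1 hx, h1, smul_smul, smul_smul] at hk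
      exact ⟨_, hk⟩
  have hssurj : ∀ z, ∃ w, s w = z := s.surjective
  have hsurj : Function.Surjective U0 := by
    intro w
    obtain ⟨x, c, hc⟩ := h.surj w
    obtain ⟨d, hd⟩ := hline x
    obtain ⟨z, hz⟩ := hssurj (c * d)
    exact ⟨z • x, by rw [hsm, hz, hc, hd, smul_smul]⟩
  let U1 : H →ₗᵢ[ℝ] H := ⟨U0, hnorm⟩
  refine ⟨LinearIsometryEquiv.ofSurjective U1 hsurj, ?_, ?_⟩
  · rcases hs with hs | hs
    · left; intro z x
      rw [LinearIsometryEquiv.coe_ofSurjective]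
      exact (hsm z x).trans (by rw [hs]; rfl)
    · right; intro z x
      rw [LinearIsometryEquiv.coe_ofSurjective]
      exact (hsm z x).trans (by rw [hs]; rfl)
  · intro x
    rw [LinearIsometryEquiv.coe_ofSurjective]
    change ∃ c : ℂ, U0 x = c • g x
    by_cases hx : x = 0
    · exact ⟨0, by rw [hx, map_zero, zero_smul]⟩
    obtain ⟨c, hc⟩ := hline x
    have hc0 : c ≠ 0 := by
      rintro rfl
      exact h.ne x hx (by rw [hc, zero_smul])
    exact ⟨c⁻¹, by rw [hc, smul_smul, inv_mul_cancel₀ hc0, one_smul]⟩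

theorem uhlhorn (hdim : 3 ≤ Module.rank ℂ H) (h : OM g) :
    ∃ U : H ≃ₗᵢ[ℝ] H,
      ((∀ (z : ℂ) (x : H), U (z • x) = z • U x) ∨
        (∀ (z : ℂ) (x : H), U (z • x) = (starRingEnd ℂ z) • U x)) ∧
      ∀ x, ∃ c : ℂ, U x = c • g x := by
  obtain ⟨v, hv, -, -⟩ := exists_orth hdim (0 : H) 0
  have hn : ∀ w : H, w ≠ 0 → ‖((‖w‖⁻¹ : ℝ) : ℂ) • w‖ = 1 := by
    intro w hw
    rw [norm_smul, Complex.norm_real, norm_inv, norm_norm, inv_mul_cancel₀ (norm_ne_zero_iff.2 hw)]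
  have he := hn v hv
  have hne : ((‖v‖⁻¹ : ℝ) : ℂ) • v ≠ 0 := by
    rw [← norm_ne_zero_iff, he]; norm_num
  have hge := h.ne _ hne
  exact uhlhorn_e hdim (g := g) (e := ((‖v‖⁻¹ : ℝ) : ℂ) • v)
    (e' := ((‖g (((‖v‖⁻¹ : ℝ) : ℂ) • v)‖⁻¹ : ℝ) : ℂ) • g (((‖v‖⁻¹ : ℝ) : ℂ) • v))
    { h with
      he := he
      he' := hn _ hge
      ex := ⟨_, by simpa using hge, rfl⟩ }

end PCP

namespace PCP

variable {H : Type*} [NormedAddCommGroup H] [InnerProductSpace ℂ H]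

theorem dichotomy' {G K : Type*} [AddCommGroup G] [AddCommGroup K] (f h : G → K)
    (hf : ∀ x y, f (x + y) = f x + f y) (hh : ∀ x y, h (x + y) = h x + h y)
    (p : G → Prop) (hp : ∀ x y, p x → p y → p (x + y)) (hS : ∀ x, p x → f x = 0 ∨ f x = h x) :
    (∀ x, p x → f x = 0) ∨ (∀ x, p x → f x = h x) := by
  by_contra hcon
  push Not at hcon
  obtain ⟨⟨x, hx, hfx⟩, ⟨y, hy, hfy⟩⟩ := hcon
  have h1 := (hS x hx).resolve_left hfx
  have h2 := (hS y hy).resolve_right hfy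
  rcases hS (x + y) (hp x y hx hy) with h3 | h3
  · rw [hf, h2, add_zero] at h3
    exact hfx h3
  · rw [hf, hh, h1] at h3
    exact hfy (add_left_cancel h3)

variable [CompleteSpace H]

/-- orthogonal projections -/
abbrev Proj (H : Type*) [NormedAddCommGroup H] [InnerProductSpace ℂ H] [CompleteSpace H] :=
  {P : H →L[ℂ] H // IsSelfAdjoint P ∧ P * P = P}

/-- commuting projections -/
def cm (P Q : Proj H) : Prop := P.1 * Q.1 = Q.1 * P.1

theorem cm.symm {P Q : Proj H} (h : cm P Q) : cm Q P := Eq.symm h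

/-- `b` lies in the double commutant of `a` -/
def dc (a b : Proj H) : Prop := ∀ S, cm S a → cm S b

/-- same commutant -/
def ce (a b : Proj H) : Prop := ∀ S, cm S a ↔ cm S b

/-- rank one projection -/
noncomputable def pr (x : H) : Proj H :=
  ⟨(Submodule.span ℂ {x}).starProjection, isSelfAdjoint_starProjection _,
    Submodule.isIdempotentElem_starProjection _⟩

theorem pr_apply (x y : H) : (pr x).1 y = (inner ℂ x y / ((‖x‖ ^ 2 : ℝ) : ℂ)) • x :=
  Submodule.starProjection_singleton ℂ y

/-- orthocomplement -/
def cpl (P : Proj H) : Proj H :=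
  ⟨1 - P.1, (IsSelfAdjoint.one _).sub P.2.1, by
    rw [mul_sub, sub_mul, sub_mul, P.2.2]; simp⟩

theorem cpl_apply (P : Proj H) (x : H) : (cpl P).1 x = x - P.1 x := rfl

theorem ce_cpl (P : Proj H) : ce P (cpl P) := by
  intro S
  simp only [cm, cpl, mul_sub, sub_mul, mul_one, one_mul, sub_right_inj]

theorem proj_inner (P : Proj H) (x y : H) : inner ℂ (P.1 x) y = inner ℂ x (P.1 y) :=
  ContinuousLinearMap.isSelfAdjoint_iff_isSymmetric.1 P.2.1 x y

theorem proj_idem (P : Proj H) (x : H) : P.1 (P.1 x) = P.1 x :=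
  congrArg (fun f : H →L[ℂ] H => f x) P.2.2

theorem pr_self (x : H) : (pr x).1 x = x :=
  Submodule.starProjection_eq_self_iff.2 (Submodule.mem_span_singleton_self x)

theorem cm_apply {P Q : Proj H} (h : cm P Q) (x : H) : P.1 (Q.1 x) = Q.1 (P.1 x) :=
  congrArg (fun f : H →L[ℂ] H => f x) h

theorem cm_pr (R : Proj H) (x : H) : cm R (pr x) ↔ R.1 x = 0 ∨ R.1 x = x := by
  constructor
  · intro h
    have h1 := cm_apply h x
    rw [pr_self, pr_apply] at h1
    set k := inner ℂ x (R.1 x) / ((‖x‖ ^ 2 : ℝ) : ℂ)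
    have h2 := proj_idem R x
    rw [h1, map_smul, h1, smul_smul, ← sub_eq_zero, ← sub_smul, smul_eq_zero] at h2
    rw [h1]
    rcases h2 with h2 | h2
    · have : k * (k - 1) = 0 := by linear_combination h2
      rcases mul_eq_zero.1 this with h3 | h3
      · left; rw [h3, zero_smul]
      · right; rw [sub_eq_zero.1 h3, one_smul]
    · left; rw [h2, smul_zero]
  · intro h
    ext y
    change R.1 ((pr x).1 y) = (pr x).1 (R.1 y)
    rw [pr_apply, pr_apply, map_smul, ← proj_inner]
    rcases h with h | h
    · rw [h]; simp
    · rw [h]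

theorem pr_eq_zero_iff (x y : H) (hx : x ≠ 0) : (pr x).1 y = 0 ↔ inner ℂ x y = 0 := by
  rw [pr_apply, smul_eq_zero, div_eq_zero_iff]
  simp [hx]

theorem cm_all (P : Proj H) (h : ∀ x, P.1 x = 0 ∨ P.1 x = x) : P.1 = 0 ∨ P.1 = 1 := by
  rcases dichotomy' (fun x => P.1 x) (fun x => x) (fun x y => map_add _ x y) (fun _ _ => rfl)
    (fun _ => True) (fun _ _ _ _ => trivial) (fun x _ => h x) with h | h
  · left; ext x; exact h x trivial
  · right; ext x; exact h x trivial

theorem trivial_iff (P : Proj H) : (∀ S, cm S P) ↔ P.1 = 0 ∨ P.1 = 1 := by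
  constructor
  · intro h
    exact cm_all P fun x => (cm_pr P x).1 (h (pr x)).symm
  · rintro (h | h) S <;> simp [cm, h]

/-- separates atoms from other projections -/
def Big (P : Proj H) : Prop := ∃ Q, cm P Q ∧ ∃ a : Fin 4 → Proj H,
  (∀ i S, cm S P → cm S Q → cm S (a i)) ∧ ∀ i j, i ≠ j → ¬ dc (a i) (a j)

theorem Big.congr {P P' : Proj H} (h : ce P P') (hb : Big P) : Big P' := by
  obtain ⟨Q, hQ, a, ha, hd⟩ := hb
  exact ⟨Q, ((h Q).1 hQ.symm).symm, a, fun i S h1 h2 => ha i S ((h S).2 h1) h2, hd⟩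

theorem two_vec (P : Proj H) (h0 : P.1 ≠ 0) (h1 : ∀ x, x ≠ 0 → P ≠ pr x) :
    ∃ x y, x ≠ 0 ∧ y ≠ 0 ∧ P.1 x = x ∧ P.1 y = y ∧ (pr x).1 y = 0 := by
  obtain ⟨v, hv⟩ : ∃ v, P.1 v ≠ 0 := by
    by_contra hcon
    push Not at hcon
    exact h0 (by ext v; exact hcon v)
  have hP := proj_idem P v
  set x := P.1 v
  have hne := h1 x hv
  obtain ⟨u, hu⟩ : ∃ u, P.1 u - (pr x).1 u ≠ 0 := by
    by_contra hcon
    push Not at hcon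
    exact hne (Subtype.ext (by ext u; exact sub_eq_zero.1 (hcon u)))
  have hc : cm P (pr x) := (cm_pr P x).2 (Or.inr hP)
  have hpp : ∀ u, P.1 ((pr x).1 u) = (pr x).1 u := by
    intro u; rw [pr_apply, map_smul, hP]
  refine ⟨x, _, hv, hu, hP, ?_, ?_⟩
  · rw [map_sub, proj_idem, hpp]
  · rw [map_sub, proj_idem, ← cm_apply hc, hpp, sub_self]

theorem mul_pr_one {R : Proj H} {x : H} (h : R.1 x = x) :
    R.1 * (pr x).1 = (pr x).1 ∧ (pr x).1 * R.1 = (pr x).1 := by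
  have h1 : R.1 * (pr x).1 = (pr x).1 := by
    ext y
    change R.1 ((pr x).1 y) = _
    rw [pr_apply, map_smul, h]
  exact ⟨h1, by rw [← (cm_pr R x).2 (Or.inr h), h1]⟩

theorem mul_pr_zero {R : Proj H} {x : H} (h : R.1 x = 0) :
    R.1 * (pr x).1 = 0 ∧ (pr x).1 * R.1 = 0 := by
  have h1 : R.1 * (pr x).1 = 0 := by
    ext y
    change R.1 ((pr x).1 y) = _
    rw [pr_apply, map_smul, h]; simp
  exact ⟨h1, by rw [← (cm_pr R x).2 (Or.inl h), h1]⟩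

theorem atom_or_big (P : Proj H) (h0 : P.1 ≠ 0) (h1 : P.1 ≠ 1) (hb : ¬ Big P) :
    ∃ x, x ≠ 0 ∧ (P = pr x ∨ P = cpl (pr x)) := by
  by_contra hcon
  push Not at hcon
  apply hb
  obtain ⟨x, x2, hx, hx2, hPx, hPx2, hxx⟩ := two_vec P h0 (fun x hx => (hcon x hx).1)
  obtain ⟨y, y2, hy, hy2, hPy, hPy2, hyy⟩ := two_vec (cpl P)
    (fun h => h1 (sub_eq_zero.1 h).symm)
    (fun x hx h => (hcon x hx).2 (by
      rw [← h]; apply Subtype.ext; change P.1 = 1 - (1 - P.1); abel))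
  rw [cpl_apply, sub_eq_self] at hPy hPy2
  obtain ⟨m1, m2⟩ := mul_pr_one hPx
  obtain ⟨m3, m4⟩ := mul_pr_zero hPy
  have m5 : (pr x).1 * (pr y).1 = 0 := by rw [← m2, mul_assoc, m3, mul_zero]
  have m6 : (pr y).1 * (pr x).1 = 0 := by rw [← m1, ← mul_assoc, m4, zero_mul]
  have px : ∀ z, P.1 z = 0 → (pr x).1 z = 0 := by
    intro z hz; rw [← m2]; change (pr x).1 (P.1 z) = 0; rw [hz, map_zero]
  have py : ∀ z, P.1 z = z → (pr y).1 z = 0 := by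
    intro z hz; rw [← hz]; exact congrArg (fun f : H →L[ℂ] H => f z) m4
  let Q : Proj H := ⟨(pr x).1 + (pr y).1, (pr x).2.1.add (pr y).2.1, by
    rw [add_mul, mul_add, mul_add, m5, m6, (pr x).2.2, (pr y).2.2]; simp⟩
  let b : Proj H := ⟨P.1 - (pr x).1, P.2.1.sub (pr x).2.1, by
    rw [sub_mul, mul_sub, mul_sub, m1, m2, (pr x).2.2, P.2.2]; simp⟩
  let d : Proj H := ⟨1 - P.1 - (pr y).1, ((IsSelfAdjoint.one _).sub P.2.1).sub (pr y).2.1, by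
    simp only [sub_mul, mul_sub, m3, m4, (pr y).2.2, P.2.2, one_mul, mul_one]; abel⟩
  have hPQ : P.1 * Q.1 = (pr x).1 := by
    change P.1 * ((pr x).1 + (pr y).1) = _
    rw [mul_add, m1, m3, add_zero]
  have hQP : Q.1 * P.1 = (pr x).1 := by
    change ((pr x).1 + (pr y).1) * P.1 = _
    rw [add_mul, m2, m4, add_zero]
  refine ⟨Q, hPQ.trans hQP.symm, ![pr x, b, pr y, d], ?_, ?_⟩
  · intro i S hSP hSQ
    have c1 : Commute S.1 P.1 := hSP
    have c2 : Commute S.1 ((pr x).1 + (pr y).1) := hSQ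
    have c3 : Commute S.1 (pr x).1 := hPQ ▸ c1.mul_right hSQ
    have c4 : Commute S.1 (pr y).1 := by simpa using c2.sub_right c3
    fin_cases i
    · exact c3
    · exact c1.sub_right c3
    · exact c4
    · exact ((Commute.one_right _).sub_right c1).sub_right c4
  · have hw0 : ∀ i, ![x, x2, y, y2] i ≠ 0 := by
      intro i; fin_cases i <;> assumption
    have ha : ∀ i j, ((![pr x, b, pr y, d] : Fin 4 → Proj H) i).1 (![x, x2, y, y2] j) =
        if i = j then ![x, x2, y, y2] j else 0 := by
      have hb : ∀ z, b.1 z = P.1 z - (pr x).1 z := fun _ => rfl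
      have hd : ∀ z, d.1 z = z - P.1 z - (pr y).1 z := fun _ => rfl
      intro i j
      fin_cases i <;> fin_cases j <;>
        simp [hb, hd, pr_self, hPx, hPx2, hPy, hPy2, hxx, hyy, px, py]
    intro i j hij hdc
    obtain ⟨k, hki, hkj⟩ : ∃ k : Fin 4, i ≠ k ∧ j ≠ k := by
      clear hdc; revert i j; decide
    have h2 := (cm_pr _ _).1 (hdc (pr (![x, x2, y, y2] j + ![x, x2, y, y2] k))
      ((cm_pr _ _).2 (by left; rw [map_add, ha, ha, if_neg hij, if_neg hki, add_zero])).symm).symm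
    rw [map_add, ha, ha, if_pos rfl, if_neg hkj, add_zero] at h2
    rcases h2 with h2 | h2
    · exact hw0 j h2
    · exact hw0 k (by simpa using h2)

/-- Elements of the double commutant of `{pr x, Q}` where `Q x = 0`. -/
theorem dcomm_struct (x : H) (Q R : Proj H) (hQ : Q.1 x = 0)
    (hR : ∀ S, cm S (pr x) → cm S Q → cm S R) :
    ∃ t : Bool × Bool, ∀ S : Proj H, cm S R ↔
      Commute S.1 ((bif t.1 then (pr x).1 else 0) + (bif t.2 then Q.1 else 0)) := by
  obtain ⟨m1, m2⟩ := mul_pr_zero hQ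
  have n1 : ∀ v, Q.1 ((pr x).1 v) = 0 := fun v => congrArg (fun f : H →L[ℂ] H => f v) m1
  have n2 : ∀ v, (pr x).1 (Q.1 v) = 0 := fun v => congrArg (fun f : H →L[ℂ] H => f v) m2
  have key : ∀ p : H → Prop, (∀ x y, p x → p y → p (x + y)) →
      (∀ y, p y → ((pr x).1 y = 0 ∨ (pr x).1 y = y) ∧ (Q.1 y = 0 ∨ Q.1 y = y)) →
      (∀ y, p y → R.1 y = 0) ∨ (∀ y, p y → R.1 y = y) := by
    intro p hp h
    refine dichotomy' (fun x => R.1 x) (fun x => x) (fun x y => map_add _ x y) (fun _ _ => rfl)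
      p hp fun y hy => ?_
    obtain ⟨h1, h2⟩ := h y hy
    exact (cm_pr R y).1 (hR _ ((cm_pr _ _).2 h1).symm ((cm_pr _ _).2 h2).symm).symm
  have k1 := key (fun y => (pr x).1 y = y) (fun a b ha hb => by rw [map_add, ha, hb])
    (fun y hy => ⟨Or.inr hy, Or.inl (by rw [← hy, n1])⟩)
  have k2 := key (fun y => Q.1 y = y) (fun a b ha hb => by rw [map_add, ha, hb])
    (fun y hy => ⟨Or.inl (by rw [← hy, n2]), Or.inr hy⟩)
  have k3 := key (fun y => (pr x).1 y = 0 ∧ Q.1 y = 0)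
    (fun a b ha hb => by rw [map_add, map_add, ha.1, hb.1, ha.2, hb.2]; simp)
    (fun y hy => ⟨Or.inl hy.1, Or.inl hy.2⟩)
  have dec : ∀ v, R.1 v = R.1 ((pr x).1 v) + R.1 (Q.1 v) + R.1 (v - (pr x).1 v - Q.1 v) := by
    intro v; rw [← map_add, ← map_add]; congr 1; abel
  have i1 : ∀ v, (pr x).1 ((pr x).1 v) = (pr x).1 v := proj_idem _
  have i2 : ∀ v, Q.1 (Q.1 v) = Q.1 v := proj_idem _
  have i3 : ∀ v, (pr x).1 (v - (pr x).1 v - Q.1 v) = 0 ∧ Q.1 (v - (pr x).1 v - Q.1 v) = 0 := by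
    intro v; simp only [map_sub, i1, i2, n1, n2]; simp
  have fin1 : ∀ T : H →L[ℂ] H, R.1 = T → ∀ S : Proj H, cm S R ↔ Commute S.1 T := by
    rintro _ rfl S; rfl
  have fin2 : ∀ T : H →L[ℂ] H, R.1 = 1 - T → ∀ S : Proj H, cm S R ↔ Commute S.1 T := by
    intro T hT S
    rw [cm, hT, Commute, SemiconjBy]
    simp only [mul_sub, sub_mul, mul_one, one_mul, sub_right_inj]
  rcases k3 with k3 | k3
  · rcases k1 with k1 | k1 <;> rcases k2 with k2 | k2
    · refine ⟨(false, false), fin1 _ ?_⟩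
      ext v; rw [dec, k1 _ (i1 v), k2 _ (i2 v), k3 _ (i3 v)]; simp
    · refine ⟨(false, true), fin1 _ ?_⟩
      ext v; rw [dec, k1 _ (i1 v), k2 _ (i2 v), k3 _ (i3 v)]; simp
    · refine ⟨(true, false), fin1 _ ?_⟩
      ext v; rw [dec, k1 _ (i1 v), k2 _ (i2 v), k3 _ (i3 v)]; simp
    · refine ⟨(true, true), fin1 _ ?_⟩
      ext v; rw [dec, k1 _ (i1 v), k2 _ (i2 v), k3 _ (i3 v)]; simp
  · rcases k1 with k1 | k1 <;> rcases k2 with k2 | k2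
    · refine ⟨(true, true), fin2 _ ?_⟩
      ext v; rw [dec, k1 _ (i1 v), k2 _ (i2 v), k3 _ (i3 v)]; simp; abel
    · refine ⟨(true, false), fin2 _ ?_⟩
      ext v; rw [dec, k1 _ (i1 v), k2 _ (i2 v), k3 _ (i3 v)]; simp
    · refine ⟨(false, true), fin2 _ ?_⟩
      ext v; rw [dec, k1 _ (i1 v), k2 _ (i2 v), k3 _ (i3 v)]; simp; abel
    · refine ⟨(false, false), fin2 _ ?_⟩
      ext v; rw [dec, k1 _ (i1 v), k2 _ (i2 v), k3 _ (i3 v)]; simp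

theorem not_big_core (x : H) (Q : Proj H) (hQ : Q.1 x = 0) (a : Fin 4 → Proj H)
    (ha : ∀ i S, cm S (pr x) → cm S Q → cm S (a i)) : ∃ i j, i ≠ j ∧ dc (a i) (a j) := by
  choose t ht using fun i => dcomm_struct x Q (a i) hQ (ha i)
  by_cases hinj : Function.Injective t
  · have hbij : Function.Bijective t := by
      rw [Fintype.bijective_iff_injective_and_card]
      exact ⟨hinj, by simp⟩
    obtain ⟨j, hj⟩ := hbij.2 (false, false)
    obtain ⟨i, hi⟩ := exists_ne j
    refine ⟨i, j, hi, fun S _ => ?_⟩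
    rw [ht, hj]; simp
  · simp only [Function.Injective, not_forall] at hinj
    obtain ⟨i, j, hij, hne⟩ := hinj
    refine ⟨i, j, hne, fun S hS => ?_⟩
    rw [ht, ← hij, ← ht]; exact hS

theorem not_big_pr (x : H) : ¬ Big (pr x) := by
  rintro ⟨Q, hQ, a, ha, hd⟩
  rcases (cm_pr Q x).1 hQ.symm with h | h
  · obtain ⟨i, j, hij, h⟩ := not_big_core x Q h a ha
    exact hd i j hij h
  · obtain ⟨i, j, hij, h⟩ := not_big_core x (cpl Q) (by rw [cpl_apply, h, sub_self]) a
      (fun i S h1 h2 => ha i S h1 ((ce_cpl Q S).2 h2))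
    exact hd i j hij h

theorem not_dc_of_orth (hdim : 3 ≤ Module.rank ℂ H) {x y : H} (hx : x ≠ 0) (hy : y ≠ 0)
    (h : inner ℂ x y = 0) : ¬ dc (pr x) (pr y) := by
  intro hdc
  obtain ⟨z, hz, hxz, hyz⟩ := exists_orth hdim x y
  have h1 := (cm_pr _ _).1 (hdc (pr (y + z)) ((cm_pr _ _).2 (by
    left; rw [pr_eq_zero_iff x _ hx, inner_add_right, h, hxz, add_zero])).symm).symm
  rw [map_add, pr_self, (pr_eq_zero_iff y z hy).2 hyz, add_zero] at h1
  rcases h1 with h1 | h1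
  · exact hy h1
  · exact hz (by simpa using h1)

theorem pr_smul {x : H} {c : ℂ} (hc : c ≠ 0) : pr (c • x) = pr x := by
  apply Subtype.ext
  simp only [pr]
  congr 1
  exact Submodule.span_singleton_smul_eq (IsUnit.mk0 c hc) x

theorem orth_iff (hdim : 3 ≤ Module.rank ℂ H) {x y : H} (hx : x ≠ 0) (hy : y ≠ 0) :
    inner ℂ x y = 0 ↔ cm (pr x) (pr y) ∧ ¬ dc (pr x) (pr y) := by
  constructor
  · intro h
    exact ⟨(cm_pr _ _).2 (Or.inl ((pr_eq_zero_iff x y hx).2 h)), not_dc_of_orth hdim hx hy h⟩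
  · rintro ⟨h1, h2⟩
    rcases (cm_pr _ _).1 h1 with h3 | h3
    · exact (pr_eq_zero_iff x y hx).1 h3
    · exfalso
      rw [pr_apply] at h3
      set c := inner ℂ x y / ((‖x‖ ^ 2 : ℝ) : ℂ)
      have hc : c ≠ 0 := by
        intro hc; rw [hc, zero_smul] at h3; exact hy h3.symm
      apply h2
      rw [← h3, pr_smul hc]
      exact fun S h => h

theorem par_of_dc (hdim : 3 ≤ Module.rank ℂ H) {x y : H} (hx : x ≠ 0) (hy : y ≠ 0)
    (h : dc (pr x) (pr y)) : ∃ c : ℂ, y = c • x := by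
  rcases (cm_pr _ _).1 (h (pr x) rfl) with h3 | h3
  · exact absurd h (not_dc_of_orth hdim hx hy ((pr_eq_zero_iff x y hx).1 h3))
  · rw [pr_apply] at h3
    exact ⟨_, h3.symm⟩

theorem pr_nontrivial (hdim : 3 ≤ Module.rank ℂ H) {x : H} (hx : x ≠ 0) :
    ¬ ∀ S, cm S (pr x) := by
  intro h
  obtain ⟨z, hz, hxz, -⟩ := exists_orth hdim x x
  have h1 := (cm_pr _ _).1 (h (pr (x + z))).symm
  rw [map_add, pr_self, (pr_eq_zero_iff x z hx).2 hxz, add_zero] at h1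
  rcases h1 with h1 | h1
  · exact hx h1
  · exact hz (by simpa using h1)

theorem atom_of (P : Proj H) (h0 : ¬ ∀ S, cm S P) (hb : ¬ Big P) :
    ∃ x, x ≠ 0 ∧ ce P (pr x) := by
  rw [trivial_iff, not_or] at h0
  obtain ⟨x, hx, h | h⟩ := atom_or_big P h0.1 h0.2 hb
  · exact ⟨x, hx, by rw [h]; exact fun S => Iff.rfl⟩
  · exact ⟨x, hx, by rw [h]; exact fun S => (ce_cpl _ S).symm⟩

theorem phi_dc (φ : Proj H → Proj H) (hbij : Function.Bijective φ)
    (hcomm : ∀ P Q : Proj H, cm P Q ↔ cm (φ P) (φ Q))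
    (a b : Proj H) : dc a b ↔ dc (φ a) (φ b) := by
  constructor
  · intro h S hS
    obtain ⟨S, rfl⟩ := hbij.2 S
    exact (hcomm _ _).1 (h S ((hcomm _ _).2 hS))
  · intro h S hS
    exact (hcomm _ _).2 (h _ ((hcomm _ _).1 hS))

theorem phi_big (φ : Proj H → Proj H) (hbij : Function.Bijective φ)
    (hcomm : ∀ P Q : Proj H, cm P Q ↔ cm (φ P) (φ Q))
    (P : Proj H) : Big P ↔ Big (φ P) := by
  constructor
  · rintro ⟨Q, hQ, a, ha, hd⟩
    refine ⟨φ Q, (hcomm _ _).1 hQ, fun i => φ (a i), fun i S h1 h2 => ?_, fun i j hij h => ?_⟩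
    · obtain ⟨S, rfl⟩ := hbij.2 S
      exact (hcomm _ _).1 (ha i S ((hcomm _ _).2 h1) ((hcomm _ _).2 h2))
    · exact hd i j hij ((phi_dc φ hbij hcomm _ _).2 h)
  · rintro ⟨Q, hQ, a, ha, hd⟩
    obtain ⟨Q, rfl⟩ := hbij.2 Q
    choose b hb using fun i => hbij.2 (a i)
    refine ⟨Q, (hcomm _ _).2 hQ, b, fun i S h1 h2 => ?_, fun i j hij h => ?_⟩
    · rw [hcomm, hb]
      exact ha i _ ((hcomm _ _).1 h1) ((hcomm _ _).1 h2)
    · apply hd i j hij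
      rw [← hb, ← hb]
      exact (phi_dc φ hbij hcomm _ _).1 h

theorem phi_triv (φ : Proj H → Proj H) (hbij : Function.Bijective φ)
    (hcomm : ∀ P Q : Proj H, cm P Q ↔ cm (φ P) (φ Q))
    (P : Proj H) : (∀ S, cm S P) ↔ ∀ S, cm S (φ P) := by
  constructor
  · intro h S
    obtain ⟨S, rfl⟩ := hbij.2 S
    exact (hcomm _ _).1 (h S)
  · intro h S
    exact (hcomm _ _).2 (h _)

theorem main_aux (hdim : 3 ≤ Module.rank ℂ H) (φ : Proj H → Proj H) (hbij : Function.Bijective φ)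
    (hcomm : ∀ P Q : Proj H, cm P Q ↔ cm (φ P) (φ Q)) :
    ∃ U : H ≃ₗᵢ[ℝ] H,
      ((∀ (z : ℂ) (x : H), U (z • x) = z • U x) ∨
        (∀ (z : ℂ) (x : H), U (z • x) = (starRingEnd ℂ z) • U x)) ∧
      ∀ P : Proj H,
        (∀ x : H, (φ P).1 x = U (P.1 (U.symm x))) ∨
        (∀ x : H, (φ P).1 x = U (U.symm x - P.1 (U.symm x))) := by
  have hex : ∀ x : H, ∃ y : H, (x = 0 → y = 0) ∧ (x ≠ 0 → y ≠ 0 ∧ ce (φ (pr x)) (pr y)) := by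
    intro x
    by_cases hx : x = 0
    · exact ⟨0, fun _ => rfl, fun h => absurd hx h⟩
    · obtain ⟨y, hy, hy'⟩ := atom_of (φ (pr x))
        (fun h => pr_nontrivial hdim hx ((phi_triv φ hbij hcomm _).2 h))
        (fun h => not_big_pr x ((phi_big φ hbij hcomm _).2 h))
      exact ⟨y, fun h => absurd h hx, fun _ => ⟨hy, hy'⟩⟩
  choose g hg0 hg using hex
  have hgne : ∀ x, x ≠ 0 → g x ≠ 0 := fun x hx => (hg x hx).1
  have hgce : ∀ x, x ≠ 0 → ∀ S, cm S (φ (pr x)) ↔ cm S (pr (g x)) := fun x hx => (hg x hx).2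
  have hgcm : ∀ P x, x ≠ 0 → (cm P (pr x) ↔ cm (φ P) (pr (g x))) := by
    intro P x hx
    rw [hcomm, hgce x hx]
  have hgcm2 : ∀ x y, x ≠ 0 → y ≠ 0 → (cm (pr x) (pr y) ↔ cm (pr (g x)) (pr (g y))) := by
    intro x y hx hy
    rw [hgcm _ _ hy]
    exact ⟨fun h => ((hgce x hx _).1 h.symm).symm, fun h => ((hgce x hx _).2 h.symm).symm⟩
  have hgdc : ∀ x y, x ≠ 0 → y ≠ 0 → (dc (pr x) (pr y) ↔ dc (pr (g x)) (pr (g y))) := by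
    intro x y hx hy
    rw [phi_dc φ hbij hcomm]
    simp only [dc, hgce x hx, hgce y hy]
  have hOM : OM g := by
    refine ⟨hg0 0 rfl, hgne, ?_, ?_⟩
    · intro x y
      by_cases hx : x = 0
      · rw [hg0 x hx, hx]; simp
      by_cases hy : y = 0
      · rw [hg0 y hy, hy]; simp
      rw [orth_iff hdim hx hy, orth_iff hdim (hgne x hx) (hgne y hy), hgcm2 x y hx hy,
        hgdc x y hx hy]
    · intro w
      by_cases hw : w = 0
      · exact ⟨0, 0, by simp [hw]⟩
      obtain ⟨P, hP⟩ := hbij.2 (pr w)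
      obtain ⟨x, hx, hPx⟩ := atom_of P
        (fun h => pr_nontrivial hdim hw (hP ▸ (phi_triv φ hbij hcomm _).1 h))
        (fun h => not_big_pr w (hP ▸ (phi_big φ hbij hcomm _).1 h))
      refine ⟨x, par_of_dc hdim (hgne x hx) hw ?_⟩
      intro S hS
      rw [← hgce x hx] at hS
      obtain ⟨S, rfl⟩ := hbij.2 S
      rw [← hcomm, ← hPx, hcomm, hP] at hS
      exact hS
  obtain ⟨U, hU, hUg⟩ := uhlhorn hdim hOM
  refine ⟨U, hU, fun P => ?_⟩
  have hiff : ∀ x, (P.1 x = 0 ∨ P.1 x = x) ↔ ((φ P).1 (U x) = 0 ∨ (φ P).1 (U x) = U x) := by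
    intro x
    by_cases hx : x = 0
    · rw [hx]; simp
    obtain ⟨c, hc⟩ := hUg x
    have hc0 : c ≠ 0 := by
      rintro rfl
      rw [zero_smul] at hc
      exact hx (by simpa using hc)
    rw [← cm_pr, ← cm_pr, hc, pr_smul hc0, hgcm P x hx]
  have hadd1 : ∀ x y, (φ P).1 (U (x + y)) = (φ P).1 (U x) + (φ P).1 (U y) := by
    intro x y; rw [map_add, map_add]
  have d1 := dichotomy' (fun x => (φ P).1 (U x)) (fun x => U x) hadd1 (fun x y => map_add _ x y)
    (fun x => P.1 x = x) (fun x y hx hy => by rw [map_add, hx, hy])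
    (fun x hx => (hiff x).1 (Or.inr hx))
  have d2 := dichotomy' (fun x => (φ P).1 (U x)) (fun x => U x) hadd1 (fun x y => map_add _ x y)
    (fun x => P.1 x = 0) (fun x y hx hy => by rw [map_add, hx, hy, add_zero])
    (fun x hx => (hiff x).1 (Or.inl hx))
  have hdec : ∀ x, (φ P).1 (U x) = (φ P).1 (U (P.1 x)) + (φ P).1 (U (x - P.1 x)) := by
    intro x; rw [← hadd1, add_sub_cancel]
  have hp1 : ∀ x, P.1 (P.1 x) = P.1 x := proj_idem P
  have hp2 : ∀ x, P.1 (x - P.1 x) = 0 := by intro x; rw [map_sub, hp1, sub_self]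
  -- reduce to statements about `U x`
  suffices hs : (∀ x, (φ P).1 (U x) = U (P.1 x)) ∨ (∀ x, (φ P).1 (U x) = U (x - P.1 x)) by
    rcases hs with hs | hs
    · left; intro x; rw [← hs, U.apply_symm_apply]
    · right; intro x; rw [← hs, U.apply_symm_apply]
  rcases d1 with d1 | d1 <;> rcases d2 with d2 | d2
  · have hz : ∀ x, (φ P).1 (U x) = 0 := by
      intro x
      rw [hdec]; exact (congrArg₂ (· + ·) (d1 _ (hp1 x)) (d2 _ (hp2 x))).trans (add_zero 0)
    rcases cm_all P (fun x => (hiff x).2 (Or.inl (hz x))) with h | h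
    · left; intro x; rw [hz, h]; simp
    · right; intro x; rw [hz, h]; simp
  · right; intro x
    rw [hdec]; exact (congrArg₂ (· + ·) (d1 _ (hp1 x)) (d2 _ (hp2 x))).trans (zero_add _)
  · left; intro x
    rw [hdec]; exact (congrArg₂ (· + ·) (d1 _ (hp1 x)) (d2 _ (hp2 x))).trans (add_zero _)
  · have hz : ∀ x, (φ P).1 (U x) = U x := by
      intro x
      rw [hdec]
      refine (congrArg₂ (· + ·) (d1 _ (hp1 x)) (d2 _ (hp2 x))).trans ?_
      rw [← map_add, add_sub_cancel]
    rcases cm_all P (fun x => (hiff x).2 (Or.inr (hz x))) with h | h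
    · right; intro x; rw [hz, h]; simp
    · left; intro x; rw [hz, h]; simp

end PCP

/-- Theorem 4.4: every commutativity-preserving (in both directions) bijection of the set
of orthogonal projections of a complex Hilbert space of dimension at least `3` is induced
by a unitary or antiunitary operator `U`, sending `P` to `UPU*` or to `UP^⊥U*`. -/
theorem projection_commutativity_preserver {H : Type*} [NormedAddCommGroup H]
    [InnerProductSpace ℂ H] [CompleteSpace H] (hdim : 3 ≤ Module.rank ℂ H)
    (φ : {P : H →L[ℂ] H // IsSelfAdjoint P ∧ P * P = P} →
      {P : H →L[ℂ] H // IsSelfAdjoint P ∧ P * P = P})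
    (hbij : Function.Bijective φ)
    (hcomm : ∀ P Q : {P : H →L[ℂ] H // IsSelfAdjoint P ∧ P * P = P},
      (P : H →L[ℂ] H) * (Q : H →L[ℂ] H) = (Q : H →L[ℂ] H) * (P : H →L[ℂ] H) ↔
        (φ P : H →L[ℂ] H) * (φ Q : H →L[ℂ] H) = (φ Q : H →L[ℂ] H) * (φ P : H →L[ℂ] H)) :
    ∃ U : H ≃ₗᵢ[ℝ] H,
      ((∀ (z : ℂ) (x : H), U (z • x) = z • U x) ∨
        (∀ (z : ℂ) (x : H), U (z • x) = (starRingEnd ℂ z) • U x)) ∧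
      ∀ P : {P : H →L[ℂ] H // IsSelfAdjoint P ∧ P * P = P},
        (∀ x : H, (φ P : H →L[ℂ] H) x = U ((P : H →L[ℂ] H) (U.symm x))) ∨
        (∀ x : H, (φ P : H →L[ℂ] H) x = U (U.symm x - (P : H →L[ℂ] H) (U.symm x))) := by
  exact PCP.main_aux hdim φ hbij hcomm
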